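/- Let α > 0, I = [a,T], let Ψ ∈ C¹(I) be increasing with Ψ'(t) > 0 for all t ∈ I, fix points a = t_0 < t_1 < ⋯ < t_m < t_{m+1} = T, and let δ ≥ 0 and β_1, …, β_m > 0 be constants. Let u, v : I → ℝ be integrable and nonnegative with v nondecreasing, and let g : I → ℝ be continuous, nonnegative and nondecreasing. If u(t) ≤ v(t) + δ u(t) + g(t) ∫_a^t Ψ'(s)(Ψ(t) − Ψ(s))^{α−1} u(s) ds + ∑_{a < t_i < t} β_i u(t_i) for all t ∈ I, then for every k ∈ {0,1,…,m} and every t ∈ (t_k, t_{k+1}], u(t) ≤ ( v(t) + δ u(t) + ∑_{i=1}^{k} β_i u(t_i) ) · E_α(Ψ̃^α_g(t,a)). -/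

import Mathlib

open MeasureTheory Finset

/-- The Mittag-Leffler function `E_α(z) = ∑_{k=0}^∞ z^k / Γ(αk + 1)`. -/
noncomputable def mittagLeffler (α z : ℝ) : ℝ :=
  ∑' k : ℕ, z ^ k / Real.Gamma (α * k + 1)

/-- `Ψ̃^α_g(t,s) := g(t) Γ(α) (Ψ(t) − Ψ(s))^α`. -/
noncomputable def psiTilde (α : ℝ) (g Ψ : ℝ → ℝ) (t s : ℝ) : ℝ :=
  g t * Real.Gamma α * (Ψ t - Ψ s) ^ α

lemma exp_neg_mul_rpow_le_Gamma_add_one {M y : ℝ} (hM : 0 < M) (hy : 0 ≤ y) :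
    Real.exp (-(M + 1)) * M ^ y ≤ Real.Gamma (y + 1) := by
  have hint := Real.GammaIntegral_convergent (s := y + 1) (by linarith)
  rw [Real.Gamma_eq_integral (by linarith)]
  have hsub : Set.Ioc M (M + 1) ⊆ Set.Ioi 0 := fun x hx => hM.trans hx.1
  calc Real.exp (-(M + 1)) * M ^ y
      = ∫ _ in Set.Ioc M (M + 1), Real.exp (-(M + 1)) * M ^ y := by simp
    _ ≤ ∫ x in Set.Ioc M (M + 1), Real.exp (-x) * x ^ (y + 1 - 1) := by
        refine setIntegral_mono_on (integrableOn_const (by simp)) (hint.mono_set hsub)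
          measurableSet_Ioc ?_
        intro x hx
        rw [add_sub_cancel_right]
        have h1 := hx.1.le
        have h2 := hx.2
        gcongr
    _ ≤ _ := by
        refine setIntegral_mono_set hint ?_ hsub.eventuallyLE
        refine ae_restrict_of_forall_mem measurableSet_Ioi fun x hx => ?_
        have : (0 : ℝ) < x := hx
        simp only [Pi.zero_apply]
        positivity

lemma summable_pow_div_Gamma {α z : ℝ} (hα : 0 < α) (hz : 0 ≤ z) :
    Summable fun k : ℕ => z ^ k / Real.Gamma (α * k + 1) := by
  set M : ℝ := (2 * z + 1) ^ (1 / α) with hMdef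
  have hM : 0 < M := by positivity
  have hMα : M ^ α = 2 * z + 1 := by
    rw [hMdef, ← Real.rpow_mul (by positivity), one_div_mul_cancel hα.ne', Real.rpow_one]
  have hr : z / (2 * z + 1) < 1 := by rw [div_lt_one (by positivity)]; linarith
  refine Summable.of_nonneg_of_le (fun k => ?_) (fun k => ?_)
    ((summable_geometric_of_lt_one (by positivity) hr).mul_left (Real.exp (M + 1)))
  · have := Real.Gamma_pos_of_pos (s := α * k + 1) (by positivity)
    positivity
  · have h := exp_neg_mul_rpow_le_Gamma_add_one hM (y := α * k) (by positivity)
    rw [Real.rpow_mul hM.le, hMα, Real.rpow_natCast] at h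
    calc z ^ k / Real.Gamma (α * k + 1)
        ≤ z ^ k / (Real.exp (-(M + 1)) * (2 * z + 1) ^ k) := by gcongr
      _ = _ := by rw [Real.exp_neg, div_pow]; field_simp

lemma pow_div_Gamma_nonneg {α z : ℝ} (hα : 0 < α) (hz : 0 ≤ z) (k : ℕ) :
    0 ≤ z ^ k / Real.Gamma (α * k + 1) :=
  div_nonneg (pow_nonneg hz k) (Real.Gamma_pos_of_pos (by positivity)).le

lemma one_le_mittagLeffler {α z : ℝ} (hα : 0 < α) (hz : 0 ≤ z) : 1 ≤ mittagLeffler α z := by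
  simpa [mittagLeffler] using (summable_pow_div_Gamma hα hz).le_tsum 0 fun k _ =>
    pow_div_Gamma_nonneg hα hz k

lemma mittagLeffler_mono {α z z' : ℝ} (hα : 0 < α) (hz : 0 ≤ z) (h : z ≤ z') :
    mittagLeffler α z ≤ mittagLeffler α z' := by
  refine (summable_pow_div_Gamma hα hz).tsum_le_tsum (fun k => ?_)
    (summable_pow_div_Gamma hα (hz.trans h))
  have := Real.Gamma_pos_of_pos (s := α * k + 1) (by positivity)
  gcongr

lemma ofReal_mittagLeffler {α z : ℝ} (hα : 0 < α) (hz : 0 ≤ z) :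
    ENNReal.ofReal (mittagLeffler α z) =
      ∑' k : ℕ, ENNReal.ofReal (z ^ k / Real.Gamma (α * k + 1)) :=
  ENNReal.ofReal_tsum_of_nonneg (pow_div_Gamma_nonneg hα hz) (summable_pow_div_Gamma hα hz)

lemma setLIntegral_ofReal_deriv_mul_comp_le {f f' : ℝ → ℝ} {s t : Set ℝ} (hs : MeasurableSet s)
    (hf : ∀ x ∈ s, HasDerivAt f (f' x) x) (hinj : Set.InjOn f s) (hmaps : Set.MapsTo f s t)
    (F : ℝ → ENNReal) :
    ∫⁻ x in s, ENNReal.ofReal (f' x) * F (f x) ≤ ∫⁻ y in t, F y := by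
  refine le_trans ?_ (lintegral_mono_set hmaps.image_subset)
  rw [lintegral_image_eq_lintegral_abs_deriv_mul hs (fun x hx => (hf x hx).hasDerivWithinAt) hinj]
  gcongr
  exact le_abs_self _

lemma setLIntegral_rpow_mul_rpow_le {p q A B : ℝ} (hp : 0 < p) (hq : 0 < q) (hAB : A ≤ B) :
    ∫⁻ y in Set.Ioc A B, ENNReal.ofReal ((B - y) ^ (p - 1) * (y - A) ^ (q - 1)) ≤
      ENNReal.ofReal ((B - A) ^ (p + q - 1) * ProbabilityTheory.beta q p) := by
  rcases hAB.eq_or_lt with rfl | hAB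
  · simp
  have hL : 0 < B - A := sub_pos.2 hAB
  have hβ := ProbabilityTheory.beta_pos hq hp
  have himage : (fun x => (B - A) * x + A) '' Set.Ioo 0 1 = Set.Ioo A B := by
    rw [Set.image_affine_Ioo hL]
    simp
  rw [← setLIntegral_congr Ioo_ae_eq_Ioc, ← himage,
    lintegral_image_eq_lintegral_abs_deriv_mul (f' := fun _ => B - A) measurableSet_Ioo
      (fun x _ => by
        simpa using (((hasDerivAt_id x).const_mul (B - A)).add_const A).hasDerivWithinAt)
      (fun x _ y _ h => by simpa [hL.ne'] using h)]
  have key : ∀ x ∈ Set.Ioo (0 : ℝ) 1, ENNReal.ofReal |B - A| * ENNReal.ofReal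
      ((B - ((B - A) * x + A)) ^ (p - 1) * ((B - A) * x + A - A) ^ (q - 1)) =
      ENNReal.ofReal ((B - A) ^ (p + q - 1) * ProbabilityTheory.beta q p) *
        ENNReal.ofReal (1 / ProbabilityTheory.beta q p * x ^ (q - 1) * (1 - x) ^ (p - 1)) := by
    intro x hx
    have h1 : 0 < 1 - x := by linarith [hx.2]
    rw [← ENNReal.ofReal_mul (by positivity), ← ENNReal.ofReal_mul (by positivity),
      abs_of_pos hL, show B - ((B - A) * x + A) = (B - A) * (1 - x) by ring, add_sub_cancel_right,
      Real.mul_rpow hL.le h1.le, Real.mul_rpow hL.le hx.1.le,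
      show p + q - 1 = 1 + (p - 1) + (q - 1) by ring, Real.rpow_add hL, Real.rpow_add hL,
      Real.rpow_one]
    congr 1
    field_simp
  rw [setLIntegral_congr_fun measurableSet_Ioo key, lintegral_const_mul' _ _ (by simp),
    ← ProbabilityTheory.lintegral_betaPDF, ProbabilityTheory.lintegral_betaPDF_eq_one hq hp,
    mul_one]

lemma setLIntegral_rpow_mul_exp_neg {p r : ℝ} (hp : 0 < p) (hr : 0 < r) :
    ∫⁻ y in Set.Ici 0, ENNReal.ofReal (y ^ (p - 1) * Real.exp (-(r * y))) =
      ENNReal.ofReal ((1 / r) ^ p * Real.Gamma p) := by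
  have hΓ := Real.Gamma_pos_of_pos hp
  have hval := Real.integral_rpow_mul_exp_neg_mul_Ioi hp hr
  have hint : IntegrableOn (fun y => y ^ (p - 1) * Real.exp (-(r * y))) (Set.Ioi 0) := by
    by_contra h
    rw [integral_undef h] at hval
    have : 0 < (1 / r) ^ p * Real.Gamma p := by positivity
    linarith
  rw [← setLIntegral_congr Ioi_ae_eq_Ici, ← hval, ofReal_integral_eq_lintegral_ofReal hint]
  refine ae_restrict_of_forall_mem measurableSet_Ioi fun y hy => ?_
  have : (0 : ℝ) < y := hy
  simp only [Pi.zero_apply]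
  positivity

/-- The `Ψ`-fractional integral `∫_a^t Ψ'(s) (Ψ(t) - Ψ(s))^(α-1) w(s) ds` of an extended
nonnegative function. -/
noncomputable def psiLIntegral (α : ℝ) (Ψ Ψ' : ℝ → ℝ) (a : ℝ) (w : ℝ → ENNReal) (t : ℝ) :
    ENNReal :=
  ∫⁻ s in Set.Ioc a t, ENNReal.ofReal (Ψ' s * (Ψ t - Ψ s) ^ (α - 1)) * w s

section psiLIntegral

variable {α a b : ℝ} {Ψ Ψ' : ℝ → ℝ}

lemma aemeasurable_psiKernel (hd : ∀ x ∈ Set.Icc a b, HasDerivAt Ψ (Ψ' x) x)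
    (hc : ContinuousOn Ψ' (Set.Icc a b)) {t : ℝ} (ht : t ∈ Set.Icc a b) :
    AEMeasurable (fun s => ENNReal.ofReal (Ψ' s * (Ψ t - Ψ s) ^ (α - 1)))
      (volume.restrict (Set.Ioc a t)) := by
  have hsub : Set.Ioc a t ⊆ Set.Icc a b := fun s hs => ⟨hs.1.le, hs.2.trans ht.2⟩
  have h1 : AEMeasurable Ψ' (volume.restrict (Set.Ioc a t)) :=
    (hc.mono hsub).aemeasurable measurableSet_Ioc
  have h2 : AEMeasurable Ψ (volume.restrict (Set.Ioc a t)) :=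
    ContinuousOn.aemeasurable (fun x hx => (hd x (hsub hx)).continuousAt.continuousWithinAt)
      measurableSet_Ioc
  exact (h1.mul ((h2.const_sub _).pow_const _)).ennreal_ofReal

lemma psiLIntegral_rpow_le (hα : 0 < α) (hd : ∀ x ∈ Set.Icc a b, HasDerivAt Ψ (Ψ' x) x)
    (hpos : ∀ x ∈ Set.Icc a b, 0 < Ψ' x) (hm : StrictMonoOn Ψ (Set.Icc a b))
    {q : ℝ} (hq : 0 < q) {t : ℝ} (ht : t ∈ Set.Icc a b) :
    psiLIntegral α Ψ Ψ' a (fun s => ENNReal.ofReal ((Ψ s - Ψ a) ^ (q - 1))) t ≤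
      ENNReal.ofReal ((Ψ t - Ψ a) ^ (α + q - 1) * ProbabilityTheory.beta q α) := by
  have hsub : Set.Ioc a t ⊆ Set.Icc a b := fun s hs => ⟨hs.1.le, hs.2.trans ht.2⟩
  have ha : a ∈ Set.Icc a b := ⟨le_rfl, ht.1.trans ht.2⟩
  refine le_trans ?_ (setLIntegral_rpow_mul_rpow_le hα hq (hm.monotoneOn ha ht ht.1))
  have hmaps : Set.MapsTo Ψ (Set.Ioc a t) (Set.Ioc (Ψ a) (Ψ t)) := fun x hx =>
    ⟨hm ha (hsub hx) hx.1, hm.monotoneOn (hsub hx) ht hx.2⟩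
  refine le_trans (le_of_eq ?_) (setLIntegral_ofReal_deriv_mul_comp_le measurableSet_Ioc
    (fun x hx => hd x (hsub hx)) (hm.injOn.mono hsub) hmaps _)
  refine setLIntegral_congr_fun measurableSet_Ioc fun s hs => ?_
  have h1 := (hpos s (hsub hs)).le
  have h2 : 0 ≤ Ψ t - Ψ s := sub_nonneg.2 (hm.monotoneOn (hsub hs) ht hs.2)
  simp only
  rw [← ENNReal.ofReal_mul h1, ← ENNReal.ofReal_mul (by positivity), mul_assoc]

lemma psiTilde_const_nonneg (hα : 0 < α) (hm : StrictMonoOn Ψ (Set.Icc a b)) {G : ℝ} (hG : 0 ≤ G)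
    {t : ℝ} (ht : t ∈ Set.Icc a b) : 0 ≤ psiTilde α (fun _ => G) Ψ t a := by
  have h : 0 ≤ Ψ t - Ψ a :=
    sub_nonneg.2 (hm.monotoneOn ⟨le_rfl, ht.1.trans ht.2⟩ ht ht.1)
  have := Real.Gamma_pos_of_pos hα
  unfold psiTilde
  positivity

lemma monotoneOn_mittagLeffler_psiTilde (hα : 0 < α) (hm : StrictMonoOn Ψ (Set.Icc a b))
    {G : ℝ} (hG : 0 ≤ G) :
    MonotoneOn (fun t => mittagLeffler α (psiTilde α (fun _ => G) Ψ t a)) (Set.Icc a b) := by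
  intro x hx y hy hxy
  have hΓα := Real.Gamma_pos_of_pos hα
  refine mittagLeffler_mono hα (psiTilde_const_nonneg hα hm hG hx) ?_
  have h1 : 0 ≤ Ψ x - Ψ a := sub_nonneg.2 (hm.monotoneOn ⟨le_rfl, hx.1.trans hx.2⟩ hx hx.1)
  have h2 := hm.monotoneOn hx hy hxy
  unfold psiTilde
  gcongr

lemma one_add_psiLIntegral_mittagLeffler_le (hα : 0 < α)
    (hd : ∀ x ∈ Set.Icc a b, HasDerivAt Ψ (Ψ' x) x) (hc : ContinuousOn Ψ' (Set.Icc a b))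
    (hpos : ∀ x ∈ Set.Icc a b, 0 < Ψ' x) (hm : StrictMonoOn Ψ (Set.Icc a b))
    {G : ℝ} (hG : 0 ≤ G) {t : ℝ} (ht : t ∈ Set.Icc a b) :
    1 + ENNReal.ofReal G * psiLIntegral α Ψ Ψ' a
        (fun s => ENNReal.ofReal (mittagLeffler α (psiTilde α (fun _ => G) Ψ s a))) t ≤
      ENNReal.ofReal (mittagLeffler α (psiTilde α (fun _ => G) Ψ t a)) := by
  have hΓα := Real.Gamma_pos_of_pos hα
  have hΓ (k : ℕ) : 0 < Real.Gamma (α * k + 1) := Real.Gamma_pos_of_pos (by positivity)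
  have hsub : Set.Ioc a t ⊆ Set.Icc a b := fun s hs => ⟨hs.1.le, hs.2.trans ht.2⟩
  have ha : a ∈ Set.Icc a b := ⟨le_rfl, ht.1.trans ht.2⟩
  have hx {s : ℝ} (hs : s ∈ Set.Icc a b) : 0 ≤ Ψ s - Ψ a := sub_nonneg.2 (hm.monotoneOn ha hs hs.1)
  have hterm {s : ℝ} (hs : s ∈ Set.Icc a b) (k : ℕ) :
      psiTilde α (fun _ => G) Ψ s a ^ k / Real.Gamma (α * k + 1) =
        (G * Real.Gamma α) ^ k / Real.Gamma (α * k + 1) * (Ψ s - Ψ a) ^ (α * k + 1 - 1) := by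
    rw [psiTilde, mul_pow, ← Real.rpow_natCast ((Ψ s - Ψ a) ^ α), ← Real.rpow_mul (hx hs),
      add_sub_cancel_right]
    ring
  have hsum : psiLIntegral α Ψ Ψ' a
      (fun s => ENNReal.ofReal (mittagLeffler α (psiTilde α (fun _ => G) Ψ s a))) t =
      ∑' k : ℕ, ENNReal.ofReal ((G * Real.Gamma α) ^ k / Real.Gamma (α * k + 1)) *
        psiLIntegral α Ψ Ψ' a (fun s => ENNReal.ofReal ((Ψ s - Ψ a) ^ (α * k + 1 - 1))) t := by
    have h2 : AEMeasurable Ψ (volume.restrict (Set.Ioc a t)) :=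
      ContinuousOn.aemeasurable (fun x hx => (hd x (hsub hx)).continuousAt.continuousWithinAt)
        measurableSet_Ioc
    have hmeas (k : ℕ) : AEMeasurable (fun s => ENNReal.ofReal (Ψ' s * (Ψ t - Ψ s) ^ (α - 1)) *
        ENNReal.ofReal ((Ψ s - Ψ a) ^ (α * k + 1 - 1))) (volume.restrict (Set.Ioc a t)) :=
      (aemeasurable_psiKernel (α := α) hd hc ht).mul
        ((h2.sub_const (Ψ a)).pow_const (α * k + 1 - 1)).ennreal_ofReal
    simp_rw [psiLIntegral, ← lintegral_const_mul' _ _ ENNReal.ofReal_ne_top]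
    rw [← lintegral_tsum fun k => (hmeas k).const_mul _]
    refine setLIntegral_congr_fun measurableSet_Ioc fun s hs => ?_
    have hs' := hsub hs
    rw [ofReal_mittagLeffler hα (psiTilde_const_nonneg hα hm hG hs'), ← ENNReal.tsum_mul_left]
    refine tsum_congr fun k => ?_
    have hcoef : 0 ≤ (G * Real.Gamma α) ^ k / Real.Gamma (α * k + 1) :=
      pow_div_Gamma_nonneg hα (by positivity) k
    rw [hterm hs', ENNReal.ofReal_mul hcoef]
    ring
  rw [hsum, ofReal_mittagLeffler hα (psiTilde_const_nonneg hα hm hG ht),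
    ← ENNReal.tsum_mul_left, tsum_eq_zero_add' (f := fun k : ℕ => ENNReal.ofReal
      (psiTilde α (fun _ => G) Ψ t a ^ k / Real.Gamma (α * k + 1))) ENNReal.summable]
  refine add_le_add (by simp) (ENNReal.tsum_le_tsum fun k => ?_)
  have h1 := hΓ k
  have h2 := hΓ (k + 1)
  have h3 := hx ht
  have hq : 0 < α * k + 1 := by positivity
  calc _ ≤ ENNReal.ofReal G *
        (ENNReal.ofReal ((G * Real.Gamma α) ^ k / Real.Gamma (α * k + 1)) * ENNReal.ofReal
          ((Ψ t - Ψ a) ^ (α + (α * k + 1) - 1) * ProbabilityTheory.beta (α * k + 1) α)) := by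
        gcongr
        exact psiLIntegral_rpow_le hα hd hpos hm hq ht
    _ = _ := by
        rw [← ENNReal.ofReal_mul (by positivity), ← ENNReal.ofReal_mul hG, hterm ht,
          ProbabilityTheory.beta, show α * k + 1 + α = α * (k + 1 : ℕ) + 1 by push_cast; ring,
          show α + (α * k + 1) - 1 = α * (k + 1 : ℕ) + 1 - 1 by push_cast; ring]
        congr 1
        field_simp
        rw [pow_succ]
        ring

lemma lintegral_Ioc_lintegral_Ioc_le_swap {f : ℝ → ℝ → ENNReal}
    (hf : AEMeasurable (Function.uncurry f)
      ((volume.restrict (Set.Ioc a b)).prod (volume.restrict (Set.Ioc a b)))) :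
    ∫⁻ t in Set.Ioc a b, ∫⁻ s in Set.Ioc a t, f t s ≤
      ∫⁻ s in Set.Ioc a b, ∫⁻ t in Set.Icc s b, f t s := by
  have hF : AEMeasurable (Function.uncurry fun t s => (Set.Iic t).indicator (f t) s)
      ((volume.restrict (Set.Ioc a b)).prod (volume.restrict (Set.Ioc a b))) := by
    have : (Function.uncurry fun t s => (Set.Iic t).indicator (f t) s) =
        {p : ℝ × ℝ | p.2 ≤ p.1}.indicator (Function.uncurry f) := by
      ext ⟨t, s⟩
      simp [Set.indicator, Function.uncurry]
    rw [this]
    exact hf.indicator (measurableSet_le measurable_snd measurable_fst)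
  calc ∫⁻ t in Set.Ioc a b, ∫⁻ s in Set.Ioc a t, f t s
      = ∫⁻ t in Set.Ioc a b, ∫⁻ s in Set.Ioc a b, (Set.Iic t).indicator (f t) s := by
        refine setLIntegral_congr_fun measurableSet_Ioc fun t ht => ?_
        rw [setLIntegral_indicator measurableSet_Iic, Set.inter_comm, Set.Ioc_inter_Iic,
          min_eq_right ht.2]
    _ = ∫⁻ s in Set.Ioc a b, ∫⁻ t in Set.Ioc a b, (Set.Iic t).indicator (f t) s :=
        lintegral_lintegral_swap hF
    _ ≤ _ := by
        refine lintegral_mono fun s => ?_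
        have : ∀ t, (Set.Iic t).indicator (f t) s = (Set.Ici s).indicator (fun t => f t s) t :=
          fun t => by simp [Set.indicator]
        simp_rw [this]
        rw [setLIntegral_indicator measurableSet_Ici]
        exact lintegral_mono_set fun t ht => ⟨ht.1, ht.2.2⟩

lemma eq_zero_of_le_psiLIntegral (hα : 0 < α)
    (hd : ∀ x ∈ Set.Icc a b, HasDerivAt Ψ (Ψ' x) x) (hc : ContinuousOn Ψ' (Set.Icc a b))
    (hpos : ∀ x ∈ Set.Icc a b, 0 < Ψ' x) (hm : StrictMonoOn Ψ (Set.Icc a b))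
    {G : ℝ} (hG : 0 ≤ G) {w : ℝ → ENNReal}
    (hw : AEMeasurable w (volume.restrict (Set.Ioc a b)))
    (hwi : ∫⁻ s in Set.Ioc a b, w s ≠ ⊤)
    (h : ∀ t ∈ Set.Icc a b, w t ≤ ENNReal.ofReal G * psiLIntegral α Ψ Ψ' a w t)
    {t : ℝ} (ht : t ∈ Set.Icc a b) : w t = 0 := by
  have hΓα := Real.Gamma_pos_of_pos hα
  have hsub : Set.Ioc a b ⊆ Set.Icc a b := Set.Ioc_subset_Icc_self
  have hΨc : ContinuousOn Ψ (Set.Icc a b) :=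
    fun x hx => (hd x hx).continuousAt.continuousWithinAt
  have hΨm : AEMeasurable Ψ (volume.restrict (Set.Ioc a b)) :=
    (hΨc.mono hsub).aemeasurable measurableSet_Ioc
  have hΨ'm : AEMeasurable Ψ' (volume.restrict (Set.Ioc a b)) :=
    (hc.mono hsub).aemeasurable measurableSet_Ioc
  -- an exponential weight with rate `r` makes the operator a contraction in `L¹`
  obtain ⟨r, hr, hrG⟩ : ∃ r : ℝ, 0 < r ∧ G * ((1 / r) ^ α * Real.Gamma α) ≤ 1 / 2 := by
    refine ⟨(2 * (G * Real.Gamma α) + 1) ^ (1 / α), by positivity, ?_⟩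
    rw [Real.div_rpow zero_le_one (by positivity), ← Real.rpow_mul (by positivity),
      one_div_mul_cancel hα.ne', Real.rpow_one, Real.one_rpow]
    have : 0 ≤ G * Real.Gamma α := by positivity
    rw [show G * (1 / (2 * (G * Real.Gamma α) + 1) * Real.Gamma α) =
      (G * Real.Gamma α) / (2 * (G * Real.Gamma α) + 1) by ring, div_le_div_iff₀ (by positivity)
      (by norm_num)]
    linarith
  set W : ℝ → ENNReal := fun t => ENNReal.ofReal (Ψ' t * Real.exp (-(r * Ψ t))) with hW
  have hWm : AEMeasurable W (volume.restrict (Set.Ioc a b)) :=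
    (hΨ'm.mul (hΨm.const_mul r).neg.exp).ennreal_ofReal
  have hinner : ∀ s ∈ Set.Ioc a b, ∫⁻ t in Set.Icc s b,
      W t * (ENNReal.ofReal (Ψ' s * (Ψ t - Ψ s) ^ (α - 1)) * w s) ≤
        ENNReal.ofReal ((1 / r) ^ α * Real.Gamma α) * (W s * w s) := by
    intro s hs
    have hs' := hsub hs
    have hsub' : Set.Icc s b ⊆ Set.Icc a b := Set.Icc_subset_Icc_left hs'.1
    have hΨs := (hpos s hs').le
    have hsplit : ∀ t ∈ Set.Icc s b,
        W t * (ENNReal.ofReal (Ψ' s * (Ψ t - Ψ s) ^ (α - 1)) * w s) =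
        ENNReal.ofReal (Ψ' t) * ((fun y => ENNReal.ofReal (y ^ (α - 1) * Real.exp (-(r * y))) *
          (W s * w s)) (Ψ t - Ψ s)) := by
      intro t ht
      have h1 := (hpos t (hsub' ht)).le
      have h2 : 0 ≤ Ψ t - Ψ s := sub_nonneg.2 (hm.monotoneOn hs' (hsub' ht) ht.1)
      simp only [hW]
      simp only [← mul_assoc]
      congr 1
      rw [← ENNReal.ofReal_mul (by positivity), ← ENNReal.ofReal_mul h1,
        ← ENNReal.ofReal_mul (by positivity),
        show -(r * Ψ t) = -(r * (Ψ t - Ψ s)) + -(r * Ψ s) by ring, Real.exp_add]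
      congr 1
      ring
    rw [setLIntegral_congr_fun measurableSet_Icc hsplit]
    have hmaps : Set.MapsTo (fun t => Ψ t - Ψ s) (Set.Icc s b) (Set.Ici 0) :=
      fun x hx => sub_nonneg.2 (hm.monotoneOn hs' (hsub' hx) hx.1)
    refine (setLIntegral_ofReal_deriv_mul_comp_le (f := fun t => Ψ t - Ψ s) measurableSet_Icc
      (fun x hx => (hd x (hsub' hx)).sub_const (Ψ s))
      (fun x hx y hy hxy => hm.injOn (hsub' hx) (hsub' hy) (sub_left_injective hxy))
      hmaps (fun y => ENNReal.ofReal (y ^ (α - 1) * Real.exp (-(r * y))) * (W s * w s))).trans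
      (le_of_eq ?_)
    rw [lintegral_mul_const _ (by fun_prop), setLIntegral_rpow_mul_exp_neg hα hr]
  set N : ENNReal := ∫⁻ s in Set.Ioc a b, W s * w s with hN
  have hNtop : N ≠ ⊤ := by
    obtain ⟨M, hM⟩ := isCompact_Icc.exists_bound_of_continuousOn
      (f := fun t => Ψ' t * Real.exp (-(r * Ψ t))) (hc.mul (hΨc.const_mul r).neg.rexp)
    refine ne_top_of_le_ne_top (ENNReal.mul_ne_top (ENNReal.ofReal_ne_top (r := M)) hwi) ?_
    rw [hN, ← lintegral_const_mul' _ _ ENNReal.ofReal_ne_top]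
    refine setLIntegral_mono' measurableSet_Ioc fun s hs => ?_
    gcongr
    exact ENNReal.ofReal_le_ofReal ((le_abs_self _).trans (hM s (hsub hs)))
  have hcontr : N ≤ ENNReal.ofReal (1 / 2) * N := by
    calc N ≤ ∫⁻ t in Set.Ioc a b, ENNReal.ofReal G * ∫⁻ s in Set.Ioc a t,
          W t * (ENNReal.ofReal (Ψ' s * (Ψ t - Ψ s) ^ (α - 1)) * w s) := by
          refine setLIntegral_mono' measurableSet_Ioc fun t ht => ?_
          rw [lintegral_const_mul' _ _ (by simp [hW]), mul_left_comm]
          gcongr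
          exact h t (hsub ht)
      _ = ENNReal.ofReal G * ∫⁻ t in Set.Ioc a b, ∫⁻ s in Set.Ioc a t,
          W t * (ENNReal.ofReal (Ψ' s * (Ψ t - Ψ s) ^ (α - 1)) * w s) :=
          lintegral_const_mul' _ _ ENNReal.ofReal_ne_top
      _ ≤ ENNReal.ofReal G * ∫⁻ s in Set.Ioc a b,
          ENNReal.ofReal ((1 / r) ^ α * Real.Gamma α) * (W s * w s) := by
          refine mul_le_mul' le_rfl ?_
          refine (lintegral_Ioc_lintegral_Ioc_le_swap ?_).trans
            (setLIntegral_mono' measurableSet_Ioc hinner)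
          exact hWm.comp_fst.mul (((hΨ'm.comp_snd.mul
            ((hΨm.comp_fst.sub hΨm.comp_snd).pow_const _)).ennreal_ofReal).mul hw.comp_snd)
      _ = ENNReal.ofReal (G * ((1 / r) ^ α * Real.Gamma α)) * N := by
          rw [lintegral_const_mul' _ _ ENNReal.ofReal_ne_top, ENNReal.ofReal_mul hG, mul_assoc]
      _ ≤ _ := by gcongr
  have hN0 : N = 0 := by
    rw [← ENNReal.ofReal_toReal hNtop, ← ENNReal.ofReal_mul (by norm_num),
      ENNReal.ofReal_le_ofReal_iff (by positivity)] at hcontr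
    have : N.toReal = 0 := by linarith [N.toReal_nonneg]
    exact ((ENNReal.toReal_eq_zero_iff _).1 this).resolve_right hNtop
  have hae : ∀ᵐ s ∂(volume.restrict (Set.Ioc a b)), w s = 0 := by
    filter_upwards [(lintegral_eq_zero_iff' (hWm.mul hw)).1 hN0,
      ae_restrict_mem measurableSet_Ioc] with s hs hs'
    have hWs : W s ≠ 0 := by
      have := hpos s (hsub hs')
      simp only [hW, ne_eq, ENNReal.ofReal_eq_zero, not_le]
      positivity
    exact (mul_eq_zero.1 hs).resolve_left hWs
  refine le_antisymm ((h t ht).trans (le_of_eq ?_)) zero_le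
  rw [psiLIntegral, lintegral_congr_ae (g := fun _ => 0), lintegral_zero, mul_zero]
  filter_upwards [ae_restrict_of_ae_restrict_of_subset (Set.Ioc_subset_Ioc_right ht.2) hae]
    with s hs
  rw [hs, mul_zero]

/-- Gronwall's inequality for the `Ψ`-fractional integral, with constant coefficients. -/
lemma le_mul_mittagLeffler_of_le_add_psiLIntegral (hα : 0 < α)
    (hd : ∀ x ∈ Set.Icc a b, HasDerivAt Ψ (Ψ' x) x) (hc : ContinuousOn Ψ' (Set.Icc a b))
    (hpos : ∀ x ∈ Set.Icc a b, 0 < Ψ' x) (hm : StrictMonoOn Ψ (Set.Icc a b))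
    {G : ℝ} (hG : 0 ≤ G) {C : ENNReal} {U : ℝ → ENNReal}
    (hU : AEMeasurable U (volume.restrict (Set.Ioc a b)))
    (hUi : ∫⁻ s in Set.Ioc a b, U s ≠ ⊤)
    (h : ∀ t ∈ Set.Icc a b, U t ≤ C + ENNReal.ofReal G * psiLIntegral α Ψ Ψ' a U t)
    {t : ℝ} (ht : t ∈ Set.Icc a b) :
    U t ≤ C * ENNReal.ofReal (mittagLeffler α (psiTilde α (fun _ => G) Ψ t a)) := by
  set V : ℝ → ENNReal :=
    fun s => ENNReal.ofReal (mittagLeffler α (psiTilde α (fun _ => G) Ψ s a)) with hV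
  have hVmono : MonotoneOn V (Set.Icc a b) := fun x hx y hy hxy =>
    ENNReal.ofReal_le_ofReal (monotoneOn_mittagLeffler_psiTilde hα hm hG hx hy hxy)
  have hVm : AEMeasurable V (volume.restrict (Set.Ioc a b)) :=
    aemeasurable_restrict_of_monotoneOn measurableSet_Ioc (hVmono.mono Set.Ioc_subset_Icc_self)
  refine tsub_eq_zero_iff_le.1 (eq_zero_of_le_psiLIntegral (w := fun s => U s - C * V s)
    hα hd hc hpos hm hG (hU.sub (hVm.const_mul C))
    (ne_top_of_le_ne_top hUi (lintegral_mono fun s => tsub_le_self)) (fun t ht => ?_) ht)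
  have hsplit : psiLIntegral α Ψ Ψ' a U t ≤
      C * psiLIntegral α Ψ Ψ' a V t + psiLIntegral α Ψ Ψ' a (fun s => U s - C * V s) t := by
    have hVt : AEMeasurable V (volume.restrict (Set.Ioc a t)) :=
      hVm.mono_set (Set.Ioc_subset_Ioc_right ht.2)
    have hKV : AEMeasurable (fun s => ENNReal.ofReal (Ψ' s * (Ψ t - Ψ s) ^ (α - 1)) * V s)
        (volume.restrict (Set.Ioc a t)) := (aemeasurable_psiKernel hd hc ht).mul hVt
    rw [psiLIntegral, psiLIntegral, psiLIntegral, ← lintegral_const_mul'' _ hKV,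
      ← lintegral_add_left' (hKV.const_mul C)]
    refine lintegral_mono fun s => ?_
    calc _ ≤ ENNReal.ofReal (Ψ' s * (Ψ t - Ψ s) ^ (α - 1)) * (C * V s + (U s - C * V s)) := by
          gcongr
          exact le_add_tsub
      _ = _ := by ring
  refine tsub_le_iff_left.2 ((h t ht).trans ?_)
  calc C + ENNReal.ofReal G * psiLIntegral α Ψ Ψ' a U t
      ≤ C + ENNReal.ofReal G * (C * psiLIntegral α Ψ Ψ' a V t +
          psiLIntegral α Ψ Ψ' a (fun s => U s - C * V s) t) := by gcongr
    _ = C * (1 + ENNReal.ofReal G * psiLIntegral α Ψ Ψ' a V t) +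
          ENNReal.ofReal G * psiLIntegral α Ψ Ψ' a (fun s => U s - C * V s) t := by ring
    _ ≤ _ := by
        gcongr
        exact one_add_psiLIntegral_mittagLeffler_le hα hd hc hpos hm hG ht

lemma ofReal_integral_le_psiLIntegral (hpos : ∀ x ∈ Set.Icc a b, 0 < Ψ' x)
    (hm : StrictMonoOn Ψ (Set.Icc a b)) {u : ℝ → ℝ} (hu : ∀ s ∈ Set.Icc a b, 0 ≤ u s)
    {t : ℝ} (ht : t ∈ Set.Icc a b) :
    ENNReal.ofReal (∫ s in a..t, Ψ' s * (Ψ t - Ψ s) ^ (α - 1) * u s) ≤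
      psiLIntegral α Ψ Ψ' a (fun s => ENNReal.ofReal (u s)) t := by
  have hsub : Set.Ioc a t ⊆ Set.Icc a b := fun s hs => ⟨hs.1.le, hs.2.trans ht.2⟩
  have hK : ∀ s ∈ Set.Ioc a t, 0 ≤ Ψ' s * (Ψ t - Ψ s) ^ (α - 1) := fun s hs =>
    mul_nonneg (hpos s (hsub hs)).le
      (Real.rpow_nonneg (sub_nonneg.2 (hm.monotoneOn (hsub hs) ht hs.2)) _)
  rw [intervalIntegral.integral_of_le ht.1]
  by_cases hint : IntegrableOn (fun s => Ψ' s * (Ψ t - Ψ s) ^ (α - 1) * u s) (Set.Ioc a t)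
  · rw [ofReal_integral_eq_lintegral_ofReal hint (ae_restrict_of_forall_mem measurableSet_Ioc
      fun s hs => mul_nonneg (hK s hs) (hu s (hsub hs)))]
    exact (setLIntegral_congr_fun measurableSet_Ioc fun s hs =>
      ENNReal.ofReal_mul (hK s hs)).le
  · rw [integral_undef hint]
    simp

/-- Real-valued form of `le_mul_mittagLeffler_of_le_add_psiLIntegral`. -/
lemma le_mul_mittagLeffler_of_le_add_integral (hα : 0 < α)
    (hd : ∀ x ∈ Set.Icc a b, HasDerivAt Ψ (Ψ' x) x) (hc : ContinuousOn Ψ' (Set.Icc a b))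
    (hpos : ∀ x ∈ Set.Icc a b, 0 < Ψ' x) (hm : StrictMonoOn Ψ (Set.Icc a b))
    {G C : ℝ} (hG : 0 ≤ G) (hC : 0 ≤ C) {u : ℝ → ℝ} (hui : IntegrableOn u (Set.Icc a b))
    (hu : ∀ s ∈ Set.Icc a b, 0 ≤ u s)
    (h : ∀ t ∈ Set.Icc a b,
      u t ≤ C + G * ∫ s in a..t, Ψ' s * (Ψ t - Ψ s) ^ (α - 1) * u s)
    {t : ℝ} (ht : t ∈ Set.Icc a b) :
    u t ≤ C * mittagLeffler α (psiTilde α (fun _ => G) Ψ t a) := by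
  have hE := one_le_mittagLeffler hα (psiTilde_const_nonneg hα hm hG ht)
  have hui' : IntegrableOn u (Set.Ioc a b) := hui.mono_set Set.Ioc_subset_Icc_self
  rw [← ENNReal.ofReal_le_ofReal_iff (by positivity), ENNReal.ofReal_mul hC]
  refine le_mul_mittagLeffler_of_le_add_psiLIntegral (U := fun s => ENNReal.ofReal (u s))
    hα hd hc hpos hm hG hui'.aemeasurable.ennreal_ofReal ?_ (fun s hs => ?_) ht
  · exact (lt_of_le_of_lt (lintegral_mono fun s => Real.ofReal_le_enorm _) hui'.2).ne
  · calc ENNReal.ofReal (u s)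
        ≤ ENNReal.ofReal C + ENNReal.ofReal
            (G * ∫ r in a..s, Ψ' r * (Ψ s - Ψ r) ^ (α - 1) * u r) :=
          (ENNReal.ofReal_le_ofReal (h s hs)).trans ENNReal.ofReal_add_le
      _ ≤ _ := by
          rw [ENNReal.ofReal_mul hG]
          gcongr
          exact ofReal_integral_le_psiLIntegral hpos hm hu hs

/-- Gronwall's inequality for the `Ψ`-fractional integral with the non-monotone forcing term
`δ * u`: the supremum of `u` over `[a, b]` satisfies the claimed bound, hence so does `u b`. -/
lemma le_add_mul_mittagLeffler_of_le_add_integral (hα : 0 < α) (hab : a ≤ b)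
    (hd : ∀ x ∈ Set.Icc a b, HasDerivAt Ψ (Ψ' x) x) (hc : ContinuousOn Ψ' (Set.Icc a b))
    (hpos : ∀ x ∈ Set.Icc a b, 0 < Ψ' x) (hm : StrictMonoOn Ψ (Set.Icc a b))
    {G C δ : ℝ} (hG : 0 ≤ G) (hC : 0 ≤ C) (hδ : 0 ≤ δ) {u : ℝ → ℝ}
    (hui : IntegrableOn u (Set.Icc a b)) (hu : ∀ s ∈ Set.Icc a b, 0 ≤ u s)
    (h : ∀ t ∈ Set.Icc a b,
      u t ≤ C + δ * u t + G * ∫ s in a..t, Ψ' s * (Ψ t - Ψ s) ^ (α - 1) * u s) :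
    u b ≤ (C + δ * u b) * mittagLeffler α (psiTilde α (fun _ => G) Ψ b a) := by
  have hb : b ∈ Set.Icc a b := ⟨hab, le_rfl⟩
  have hub := hu b hb
  have hmono {G' : ℝ} (hG' : 0 ≤ G') := monotoneOn_mittagLeffler_psiTilde (a := a) hα hm hG'
  have hE := one_le_mittagLeffler hα (psiTilde_const_nonneg hα hm hG hb)
  set E := mittagLeffler α (psiTilde α (fun _ => G) Ψ b a)
  rcases le_or_gt 1 (δ * E) with hδE | hδE
  · have h1 : u b * 1 ≤ u b * (δ * E) := mul_le_mul_of_nonneg_left hδE hub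
    have h2 : 0 ≤ C * E := by positivity
    linarith
  have hδ1 : 0 < 1 - δ := by nlinarith
  have hbdd : BddAbove (u '' Set.Icc a b) := by
    have hG' : 0 ≤ G / (1 - δ) := by positivity
    refine ⟨C / (1 - δ) * mittagLeffler α (psiTilde α (fun _ => G / (1 - δ)) Ψ b a), ?_⟩
    rintro _ ⟨s, hs, rfl⟩
    refine (le_mul_mittagLeffler_of_le_add_integral hα hd hc hpos hm hG'
      (C := C / (1 - δ)) (by positivity) hui hu (fun t ht => ?_) hs).trans
      (mul_le_mul_of_nonneg_left (hmono hG' hs hb hs.2) (by positivity))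
    rw [div_mul_eq_mul_div, ← add_div, le_div_iff₀ hδ1]
    linarith [h t ht]
  set S := sSup (u '' Set.Icc a b)
  have hle : ∀ s ∈ Set.Icc a b, u s ≤ S := fun s hs => le_csSup hbdd ⟨s, hs, rfl⟩
  have hS : 0 ≤ S := hub.trans (hle b hb)
  have hSE : S ≤ (C + δ * S) * E := by
    refine csSup_le ⟨u b, b, hb, rfl⟩ ?_
    rintro _ ⟨s, hs, rfl⟩
    refine (le_mul_mittagLeffler_of_le_add_integral hα hd hc hpos hm hG
      (C := C + δ * S) (by positivity) hui hu (fun t ht => ?_) hs).trans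
      (mul_le_mul_of_nonneg_left (hmono hG hs hb hs.2) (by positivity))
    have := mul_le_mul_of_nonneg_left (hle t ht) hδ
    linarith [h t ht]
  have := mul_le_mul_of_nonneg_right (hle b hb) (sub_nonneg.2 hδE.le)
  linarith

end psiLIntegral

/-- Intermediate estimate in the proof of Theorem 2 of the paper. -/
theorem impulsive_psi_fractional_gronwall_intermediate
    (α a T : ℝ) (hα : 0 < α) (haT : a < T)
    (Ψ Ψ' : ℝ → ℝ)
    (hΨderiv : ∀ t ∈ Set.Icc a T, HasDerivAt Ψ (Ψ' t) t)
    (hΨ'cont : ContinuousOn Ψ' (Set.Icc a T))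
    (hΨ'pos : ∀ t ∈ Set.Icc a T, 0 < Ψ' t)
    (hΨmono : StrictMonoOn Ψ (Set.Icc a T))
    (m : ℕ) (tp : ℕ → ℝ)
    (htp0 : tp 0 = a) (htpT : tp (m + 1) = T)
    (htp_mono : ∀ i ≤ m, tp i < tp (i + 1))
    (δ : ℝ) (hδ : 0 ≤ δ)
    (β : ℕ → ℝ) (hβ : ∀ i, 1 ≤ i → i ≤ m → 0 < β i)
    (u v g : ℝ → ℝ)
    (hu_int : IntegrableOn u (Set.Icc a T))
    (hv_int : IntegrableOn v (Set.Icc a T))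
    (hu_nonneg : ∀ t ∈ Set.Icc a T, 0 ≤ u t)
    (hv_nonneg : ∀ t ∈ Set.Icc a T, 0 ≤ v t)
    (hv_mono : MonotoneOn v (Set.Icc a T))
    (hg_cont : ContinuousOn g (Set.Icc a T))
    (hg_nonneg : ∀ t ∈ Set.Icc a T, 0 ≤ g t)
    (hg_mono : MonotoneOn g (Set.Icc a T))
    (hineq : ∀ t ∈ Set.Icc a T,
      u t ≤ v t + δ * u t + g t * (∫ s in a..t, Ψ' s * (Ψ t - Ψ s) ^ (α - 1) * u s) +
        ∑ i ∈ (Finset.Icc 1 m).filter (fun i => tp i < t), β i * u (tp i)) :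
    ∀ k ≤ m, ∀ t ∈ Set.Ioc (tp k) (tp (k + 1)),
      u t ≤ (v t + δ * u t + ∑ i ∈ Finset.Icc 1 k, β i * u (tp i)) *
        mittagLeffler α (psiTilde α g Ψ t a) := by
  intro k hk t ht
  have htp {i j : ℕ} (hij : i ≤ j) (hj : j ≤ m + 1) : tp i ≤ tp j := by
    induction j, hij using Nat.le_induction with
    | base => rfl
    | succ j _ ih => exact (ih (by omega)).trans (htp_mono j (by omega)).le
  have htpI {i : ℕ} (hi : i ≤ m + 1) : tp i ∈ Set.Icc a T :=
    ⟨htp0 ▸ htp (Nat.zero_le i) hi, htpT ▸ htp hi le_rfl⟩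
  have htI : t ∈ Set.Icc a T :=
    ⟨(htpI (by omega : k ≤ m + 1)).1.trans ht.1.le, ht.2.trans (htpI (by omega)).2⟩
  have hsub : Set.Icc a t ⊆ Set.Icc a T := Set.Icc_subset_Icc_right htI.2
  have hterm : ∀ i ∈ Finset.Icc 1 k, 0 ≤ β i * u (tp i) := fun i hi => by
    rw [Finset.mem_Icc] at hi
    exact mul_nonneg (hβ i hi.1 (hi.2.trans hk)).le (hu_nonneg _ (htpI (by omega)))
  have hsum := Finset.sum_nonneg hterm
  have hmain := le_add_mul_mittagLeffler_of_le_add_integral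
    (C := v t + ∑ i ∈ Finset.Icc 1 k, β i * u (tp i)) hα htI.1
    (fun x hx => hΨderiv x (hsub hx)) (hΨ'cont.mono hsub) (fun x hx => hΨ'pos x (hsub hx))
    (hΨmono.mono hsub) (hg_nonneg t htI) (add_nonneg (hv_nonneg t htI) hsum) hδ
    (hu_int.mono_set hsub) (fun s hs => hu_nonneg s (hsub hs)) (fun s hs => ?_)
  · rw [add_right_comm]
    exact hmain
  have hsI := hsub hs
  have hint : 0 ≤ ∫ r in a..s, Ψ' r * (Ψ s - Ψ r) ^ (α - 1) * u r := by
    refine intervalIntegral.integral_nonneg hs.1 fun r hr => ?_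
    have hrI : r ∈ Set.Icc a T := ⟨hr.1, hr.2.trans hsI.2⟩
    exact mul_nonneg (mul_nonneg (hΨ'pos r hrI).le (Real.rpow_nonneg
      (sub_nonneg.2 (hΨmono.monotoneOn hrI hsI hr.2)) _)) (hu_nonneg r hrI)
  have hfilter : (Finset.Icc 1 m).filter (fun i => tp i < s) ⊆ Finset.Icc 1 k := by
    intro i hi
    rw [Finset.mem_filter, Finset.mem_Icc] at hi
    rw [Finset.mem_Icc]
    refine ⟨hi.1.1, ?_⟩
    by_contra! hki
    have := htp (Nat.succ_le_of_lt hki) (by omega : i ≤ m + 1)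
    linarith [hi.2, hs.2, ht.2]
  have h1 := hineq s hsI
  have h2 := hv_mono hsI htI hs.2
  have h3 := mul_le_mul_of_nonneg_right (hg_mono hsI htI hs.2) hint
  have h4 := Finset.sum_le_sum_of_subset_of_nonneg hfilter fun i hi _ => hterm i hi
  linarith
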